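/- Let Φ be a family of open subintervals of [0,1]. Suppose there exists C > 0 such that for every interval (a,b) ⊆ [0,1] there is an interval Δ(a,b) ∈ Φ with (a+b)/2 ∈ Δ(a,b), Δ(a,b) ⊆ (a,b), and (b−a)/|Δ(a,b)| ≤ C. Then Φ is faithful for packing dimension calculation in [0,1], i.e. dim_P(E,Φ) = dim_{P(unc)}(E) = dim_P(E) for every E ⊆ [0,1]. -/

import Mathlib

open Metric Set Filter MeasureTheory
open scoped ENNReal Classical

noncomputable section

variable {M : Type*} [MetricSpace M]

/-- The centered `α`-dimensional packing `ε`-premeasure of `E`: the supremum of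
`∑ |E_i|^α` over countable families of pairwise disjoint open balls of diameter
at most `ε` with centers in `E`. -/
def cPackPre (α ε : ℝ) (E : Set M) : ℝ≥0∞ :=
  ⨆ (P : Set (M × ℝ)) (_ : P.Countable)
    (_ : ∀ p ∈ P, p.1 ∈ E ∧ 0 < p.2 ∧ EMetric.diam (ball p.1 p.2) ≤ ENNReal.ofReal ε)
    (_ : P.Pairwise fun p q => Disjoint (ball p.1 p.2) (ball q.1 q.2)),
    ∑' p : P, EMetric.diam (ball p.1.1 p.1.2) ^ α

/-- The centered packing quasi-measure `P^α_0(E) = lim_{ε→0} P^α_ε(E)`. -/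
def cPackPre0 (α : ℝ) (E : Set M) : ℝ≥0∞ := ⨅ (ε : ℝ) (_ : 0 < ε), cPackPre α ε E

/-- The centered `α`-dimensional packing measure. -/
def cPackMeasure (α : ℝ) (E : Set M) : ℝ≥0∞ :=
  ⨅ (c : ℕ → Set M) (_ : E ⊆ ⋃ n, c n), ∑' n, cPackPre0 α (c n)

/-- The packing dimension `dim_P(E) = inf {α ≥ 0 : P^α(E) = 0}`. -/
def cPackDim (E : Set M) : ℝ≥0∞ :=
  ⨅ (α : ℝ) (_ : 0 ≤ α) (_ : cPackMeasure α E = 0), ENNReal.ofReal α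

/-- The uncentered `α`-dimensional packing `ε`-premeasure of `E`: as `cPackPre`
but each ball is only required to meet `E`. -/
def uPackPre (α ε : ℝ) (E : Set M) : ℝ≥0∞ :=
  ⨆ (P : Set (M × ℝ)) (_ : P.Countable)
    (_ : ∀ p ∈ P, (ball p.1 p.2 ∩ E).Nonempty ∧ 0 < p.2 ∧
        EMetric.diam (ball p.1 p.2) ≤ ENNReal.ofReal ε)
    (_ : P.Pairwise fun p q => Disjoint (ball p.1 p.2) (ball q.1 q.2)),
    ∑' p : P, EMetric.diam (ball p.1.1 p.1.2) ^ α

/-- The uncentered packing quasi-measure. -/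
def uPackPre0 (α : ℝ) (E : Set M) : ℝ≥0∞ := ⨅ (ε : ℝ) (_ : 0 < ε), uPackPre α ε E

/-- The uncentered `α`-dimensional packing measure. -/
def uPackMeasure (α : ℝ) (E : Set M) : ℝ≥0∞ :=
  ⨅ (c : ℕ → Set M) (_ : E ⊆ ⋃ n, c n), ∑' n, uPackPre0 α (c n)

/-- The uncentered packing dimension `dim_{P(unc)}(E)`. -/
def uPackDim (E : Set M) : ℝ≥0∞ :=
  ⨅ (α : ℝ) (_ : 0 ≤ α) (_ : uPackMeasure α E = 0), ENNReal.ofReal α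

/-- The `α`-dimensional packing `ε`-premeasure of `E` with respect to a family `Φ`:
supremum of `∑ |E_i|^α` over countable pairwise disjoint families of sets from `Φ`
of diameter at most `ε`, each meeting `E`. -/
def famPackPre (α ε : ℝ) (E : Set M) (Φ : Set (Set M)) : ℝ≥0∞ :=
  ⨆ (P : Set (Set M)) (_ : P.Countable) (_ : P ⊆ Φ)
    (_ : ∀ B ∈ P, (B ∩ E).Nonempty ∧ EMetric.diam B ≤ ENNReal.ofReal ε)
    (_ : P.Pairwise Disjoint),
    ∑' B : P, EMetric.diam (B : Set M) ^ α

/-- Packing quasi-measure with respect to `Φ`. -/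
def famPackPre0 (α : ℝ) (E : Set M) (Φ : Set (Set M)) : ℝ≥0∞ :=
  ⨅ (ε : ℝ) (_ : 0 < ε), famPackPre α ε E Φ

/-- Packing measure with respect to `Φ`. -/
def famPackMeasure (α : ℝ) (E : Set M) (Φ : Set (Set M)) : ℝ≥0∞ :=
  ⨅ (c : ℕ → Set M) (_ : E ⊆ ⋃ n, c n), ∑' n, famPackPre0 α (c n) Φ

/-- Packing dimension of `E` with respect to the family `Φ`. -/
def famPackDim (E : Set M) (Φ : Set (Set M)) : ℝ≥0∞ :=
  ⨅ (α : ℝ) (_ : 0 ≤ α) (_ : famPackMeasure α E Φ = 0), ENNReal.ofReal α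

/-- The packing dimension of a measure: `inf {dim_P E : μ E = 1}`. -/
def measPackDim (μ : Measure ℝ) : ℝ≥0∞ := ⨅ (E : Set ℝ) (_ : μ E = 1), cPackDim E


lemma emetricDiam_ball_real (x : ℝ) (r : ℝ) :
    EMetric.diam (ball x r) = ENNReal.ofReal (2 * r) := by
  change Metric.ediam (ball x r) = _
  rw [Real.ball_eq_Ioo, Real.ediam_Ioo]
  congr 1
  ring

/-- The cardinality of every `r`-separated finite subset of `A` is `O(r ^ (-β))` as `r → 0`. -/
def HasSeparatedBound (A : Set ℝ) (β : ℝ) : Prop :=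
  ∃ ε K : ℝ, 0 < ε ∧ ∀ r, 0 < r → r ≤ ε → ∀ F : Finset ℝ, (F : Set ℝ) ⊆ A →
    ((F : Set ℝ).Pairwise fun x y => r ≤ |x - y|) → F.card * r ^ β ≤ K

lemma card_le_of_disjoint_ball_of_separated {A : Set ℝ} {r c : ℝ} (hr : 0 < r)
    (hA : ∀ F : Finset ℝ, (F : Set ℝ) ⊆ A →
      ((F : Set ℝ).Pairwise fun x y => r ≤ |x - y|) → (F.card : ℝ) ≤ c)
    (G : Finset (ℝ × ℝ)) (hG : ∀ p ∈ G, (ball p.1 p.2 ∩ A).Nonempty ∧ r < 2 * p.2 ∧ p.2 ≤ r)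
    (hd : (G : Set (ℝ × ℝ)).Pairwise fun p q => Disjoint (ball p.1 p.2) (ball q.1 q.2)) :
    (G.card : ℝ) ≤ 4 * c := by
  have hne : ∀ p : ℝ × ℝ, ∃ e, p ∈ G → e ∈ ball p.1 p.2 ∧ e ∈ A := fun p => by
    by_cases hp : p ∈ G
    · obtain ⟨e, he⟩ := (hG p hp).1
      exact ⟨e, fun _ => he⟩
    · exact ⟨0, fun h => absurd h hp⟩
  choose e he using hne
  have hmaps : ∀ p ∈ G, ⌊p.1 / r⌋ % 4 ∈ Finset.Ico (0 : ℤ) 4 := fun p _ => by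
    rw [Finset.mem_Ico]
    omega
  have hfib : ∀ j ∈ Finset.Ico (0 : ℤ) 4,
      ((G.filter fun p => ⌊p.1 / r⌋ % 4 = j).card : ℝ) ≤ c := by
    intro j _
    have hsep : ∀ p ∈ G.filter (fun p => ⌊p.1 / r⌋ % 4 = j),
        ∀ q ∈ G.filter (fun p => ⌊p.1 / r⌋ % 4 = j), p ≠ q → r ≤ |e p - e q| := by
      intro p hp q hq hpq
      rw [Finset.mem_filter] at hp hq
      obtain ⟨hp, hpj⟩ := hp
      obtain ⟨hq, hqj⟩ := hq
      have hep := (he p hp).1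
      have heq := (he q hq).1
      rw [mem_ball, Real.dist_eq, abs_lt] at hep heq
      obtain ⟨_, hp1, hp2⟩ := hG p hp
      obtain ⟨_, hq1, hq2⟩ := hG q hq
      have hdist := (disjoint_ball_ball_iff (by linarith) (by linarith)).1 (hd hp hq hpq)
      rw [Real.dist_eq] at hdist
      have hfl : ⌊p.1 / r⌋ ≠ ⌊q.1 / r⌋ := by
        intro h
        have h1 := Int.abs_sub_lt_one_of_floor_eq_floor h
        rw [← sub_div, abs_div, abs_of_pos hr, div_lt_one hr] at h1
        linarith
      have hp3 := (le_div_iff₀ hr).1 (Int.floor_le (p.1 / r))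
      have hq3 := (le_div_iff₀ hr).1 (Int.floor_le (q.1 / r))
      have hp4 := (div_lt_iff₀ hr).1 (Int.lt_floor_add_one (p.1 / r))
      have hq4 := (div_lt_iff₀ hr).1 (Int.lt_floor_add_one (q.1 / r))
      rcases lt_or_gt_of_ne hfl with hlt | hlt
      · have h4 : (⌊p.1 / r⌋ : ℝ) + 4 ≤ ⌊q.1 / r⌋ := by
          have : ⌊p.1 / r⌋ + 4 ≤ ⌊q.1 / r⌋ := by omega
          exact_mod_cast this
        have := mul_le_mul_of_nonneg_right h4 hr.le
        refine le_trans ?_ (neg_le_abs _)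
        linarith
      · have h4 : (⌊q.1 / r⌋ : ℝ) + 4 ≤ ⌊p.1 / r⌋ := by
          have : ⌊q.1 / r⌋ + 4 ≤ ⌊p.1 / r⌋ := by omega
          exact_mod_cast this
        have := mul_le_mul_of_nonneg_right h4 hr.le
        refine le_trans ?_ (le_abs_self _)
        linarith
    rw [← Finset.card_image_of_injOn (f := e)]
    · apply hA
      · intro x hx
        obtain ⟨p, hp, rfl⟩ := Finset.mem_image.1 (Finset.mem_coe.1 hx)
        exact (he p (Finset.mem_filter.1 hp).1).2
      · intro x hx y hy hxy
        obtain ⟨p, hp, rfl⟩ := Finset.mem_image.1 (Finset.mem_coe.1 hx)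
        obtain ⟨q, hq, rfl⟩ := Finset.mem_image.1 (Finset.mem_coe.1 hy)
        exact hsep p hp q hq fun h => hxy (h ▸ rfl)
    · intro p hp q hq hpq
      by_contra hne
      have := hsep p hp q hq hne
      rw [hpq, sub_self, abs_zero] at this
      linarith
  rw [Finset.card_eq_sum_card_fiberwise hmaps]
  push_cast
  refine (Finset.sum_le_card_nsmul _ _ _ hfib).trans_eq ?_
  simp

lemma exists_uPackPre_lt_top {A : Set ℝ} {β γ : ℝ} (hβ : 0 ≤ β) (hβγ : β < γ)
    (hA : HasSeparatedBound A β) : ∃ ε > 0, uPackPre γ ε A < ∞ := by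
  obtain ⟨ε₀, K, hε₀, hA⟩ := hA
  have hγ : 0 ≤ γ := hβ.trans hβγ.le
  have hK : 0 ≤ K := by simpa using hA ε₀ hε₀ le_rfl ∅ (by simp) (by simp)
  set q : ℝ := (1 / 2) ^ (γ - β) with hq
  have hq0 : 0 ≤ q := by positivity
  have hq1 : q < 1 := Real.rpow_lt_one (by norm_num) (by norm_num) (sub_pos.2 hβγ)
  refine ⟨min ε₀ 1, by positivity,
    lt_of_le_of_lt (b := ENNReal.ofReal (4 * K * 2 ^ γ * (1 - q)⁻¹)) ?_ ENNReal.ofReal_lt_top⟩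
  refine iSup_le fun P => iSup_le fun _ => iSup_le fun hP => iSup_le fun hd => ?_
  have hP' : ∀ p ∈ P, (ball p.1 p.2 ∩ A).Nonempty ∧ 0 < p.2 ∧ 2 * p.2 ≤ ε₀ ∧ 2 * p.2 ≤ 1 := by
    intro p hp
    obtain ⟨h1, h2, h3⟩ := hP p hp
    rw [emetricDiam_ball_real, ENNReal.ofReal_le_ofReal_iff (by positivity), le_min_iff] at h3
    exact ⟨h1, h2, h3⟩
  have hscale : ∀ p : ℝ × ℝ, ∃ k : ℕ, p ∈ P →
      (1 / 2 : ℝ) ^ (k + 1) < 2 * p.2 ∧ 2 * p.2 ≤ (1 / 2) ^ k := by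
    intro p
    by_cases hp : p ∈ P
    · obtain ⟨_, h1, _, h2⟩ := hP' p hp
      obtain ⟨k, hk⟩ := exists_nat_pow_near_of_lt_one (x := 2 * p.2) (y := 1 / 2) (by positivity) h2
        (by norm_num) (by norm_num)
      exact ⟨k, fun _ => hk⟩
    · exact ⟨0, fun h => absurd h hp⟩
  choose κ hκ using hscale
  have hlevel : ∀ (G : Finset (ℝ × ℝ)), (G : Set (ℝ × ℝ)) ⊆ P → ∀ k,
      ∑ p ∈ G with κ p = k, (2 * p.2) ^ γ ≤ 4 * K * 2 ^ γ * q ^ k := by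
    intro G hG k
    set r : ℝ := (1 / 2) ^ (k + 1) with hr
    have hr0 : 0 < r := by positivity
    have h2r : 2 * r = (1 / 2) ^ k := by rw [hr, pow_succ]; ring
    rcases (G.filter fun p => κ p = k).eq_empty_or_nonempty with he | ⟨p₀, hp₀⟩
    · rw [he, Finset.sum_empty]
      positivity
    have hmem : ∀ p ∈ G.filter fun p => κ p = k, p ∈ P ∧ r < 2 * p.2 ∧ p.2 ≤ r := by
      intro p hp
      rw [Finset.mem_filter] at hp
      have h1 := hκ p (hG hp.1)
      rw [hp.2, ← h2r] at h1
      exact ⟨hG hp.1, h1.1, by linarith⟩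
    have hrε : r ≤ ε₀ := by
      obtain ⟨h1, h2, _⟩ := hmem p₀ hp₀
      exact h2.le.trans (hP' p₀ h1).2.2.1
    have hcard : ((G.filter fun p => κ p = k).card : ℝ) ≤ 4 * (K / r ^ β) := by
      refine card_le_of_disjoint_ball_of_separated hr0 (fun F hF hs => ?_) _
        (fun p hp => ⟨(hP' p (hmem p hp).1).1, (hmem p hp).2⟩)
        (fun p hp q hq => hd (hmem p hp).1 (hmem q hq).1)
      rw [le_div_iff₀ (by positivity)]
      exact hA r hr0 hrε F hF hs
    have hpow : r ^ γ = r ^ (γ - β) * r ^ β := by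
      rw [← Real.rpow_add hr0, sub_add_cancel]
    have hrq : r ^ (γ - β) = q ^ (k + 1) := by
      rw [hr, hq, ← Real.rpow_natCast, ← Real.rpow_mul (by norm_num), mul_comm,
        Real.rpow_mul (by norm_num), Real.rpow_natCast]
    calc ∑ p ∈ G with κ p = k, (2 * p.2) ^ γ
        ≤ ∑ p ∈ G with κ p = k, (2 * r) ^ γ := by
          refine Finset.sum_le_sum fun p hp => ?_
          obtain ⟨_, h1, h2⟩ := hmem p hp
          exact Real.rpow_le_rpow (by linarith) (by linarith) hγ
      _ = (G.filter fun p => κ p = k).card * (2 ^ γ * r ^ γ) := by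
          rw [Finset.sum_const, nsmul_eq_mul, Real.mul_rpow (by norm_num) hr0.le]
      _ ≤ 4 * (K / r ^ β) * (2 ^ γ * r ^ γ) := by gcongr
      _ = 4 * K * 2 ^ γ * q ^ (k + 1) := by
          rw [hpow, hrq]
          have : r ^ β ≠ 0 := by positivity
          field_simp
      _ ≤ 4 * K * 2 ^ γ * q ^ k := by
          gcongr 4 * K * 2 ^ γ * ?_
          exact pow_le_pow_of_le_one hq0 hq1.le k.le_succ
  rw [ENNReal.tsum_eq_iSup_sum]
  refine iSup_le fun s => ?_
  set G : Finset (ℝ × ℝ) := s.map (Function.Embedding.subtype _) with hGdef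
  have hG : (G : Set (ℝ × ℝ)) ⊆ P := by
    intro p hp
    obtain ⟨x, _, rfl⟩ := Finset.mem_map.1 (Finset.mem_coe.1 hp)
    exact x.2
  calc ∑ p ∈ s, EMetric.diam (ball p.1.1 p.1.2) ^ γ
      = ∑ p ∈ G, ENNReal.ofReal ((2 * p.2) ^ γ) := by
        rw [hGdef, Finset.sum_map]
        refine Finset.sum_congr rfl fun p _ => ?_
        have := (hP' p.1 p.2).2.1
        rw [emetricDiam_ball_real, ENNReal.ofReal_rpow_of_nonneg (by linarith) hγ]
        rfl
    _ = ENNReal.ofReal (∑ p ∈ G, (2 * p.2) ^ γ) := by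
        rw [ENNReal.ofReal_sum_of_nonneg]
        intro p hp
        have := (hP' p (hG hp)).2.1
        positivity
    _ ≤ ENNReal.ofReal (4 * K * 2 ^ γ * (1 - q)⁻¹) := by
        refine ENNReal.ofReal_le_ofReal ?_
        rw [← Finset.sum_fiberwise_of_maps_to (t := G.image κ)
          fun p hp => Finset.mem_image_of_mem κ hp]
        refine (Finset.sum_le_sum fun k _ => hlevel G hG k).trans ?_
        rw [← Finset.mul_sum, ← tsum_geometric_of_lt_one hq0 hq1]
        gcongr
        exact (summable_geometric_of_lt_one hq0 hq1).sum_le_tsum _ fun k _ => by positivity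

lemma uPackPre0_eq_zero_of_uPackPre_lt_top {M : Type*} [MetricSpace M] {A : Set M} {γ α ε : ℝ}
    (hγα : γ < α) (hγ : 0 ≤ γ) (hε : 0 < ε) (hA : uPackPre γ ε A < ∞) : uPackPre0 α A = 0 := by
  have hle : ∀ δ : ℝ, 0 < δ → δ ≤ ε →
      uPackPre0 α A ≤ ENNReal.ofReal δ ^ (α - γ) * uPackPre γ ε A := by
    intro δ hδ hδε
    refine (iInf₂_le δ hδ).trans ?_
    refine iSup_le fun P => iSup_le fun hc => iSup_le fun hP => iSup_le fun hd => ?_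
    calc ∑' p : P, EMetric.diam (ball p.1.1 p.1.2) ^ α
        ≤ ∑' p : P, ENNReal.ofReal δ ^ (α - γ) * EMetric.diam (ball p.1.1 p.1.2) ^ γ := by
          refine ENNReal.tsum_le_tsum fun p => ?_
          conv_lhs => rw [← sub_add_cancel α γ]
          rw [ENNReal.rpow_add_of_nonneg _ _ (sub_pos.2 hγα).le hγ]
          gcongr
          exact (hP p.1 p.2).2.2
      _ = ENNReal.ofReal δ ^ (α - γ) * ∑' p : P, EMetric.diam (ball p.1.1 p.1.2) ^ γ :=
          ENNReal.tsum_mul_left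
      _ ≤ _ := by
          gcongr
          exact le_iSup_of_le P <| le_iSup_of_le hc <| le_iSup_of_le
            (fun p hp => ⟨(hP p hp).1, (hP p hp).2.1,
              (hP p hp).2.2.trans (ENNReal.ofReal_le_ofReal hδε)⟩) <|
            le_iSup_of_le hd le_rfl
  have hlim : Tendsto (fun δ : ℝ => ENNReal.ofReal δ ^ (α - γ) * uPackPre γ ε A)
      (nhdsWithin 0 (Ioi 0)) (nhds 0) := by
    have h1 : Tendsto (fun δ : ℝ => ENNReal.ofReal δ ^ (α - γ)) (nhdsWithin 0 (Ioi 0)) (nhds 0) := by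
      have h2 : Continuous fun δ : ℝ => ENNReal.ofReal δ ^ (α - γ) :=
        ENNReal.continuous_rpow_const.comp ENNReal.continuous_ofReal
      have h3 := (h2.tendsto 0).mono_left (nhdsWithin_le_nhds (s := Ioi 0))
      simpa [ENNReal.zero_rpow_of_pos (sub_pos.2 hγα)] using h3
    simpa using ENNReal.Tendsto.mul_const h1 (Or.inr hA.ne)
  refine le_antisymm (ge_of_tendsto hlim ?_) zero_le
  filter_upwards [Ioc_mem_nhdsGT hε] with δ hδ using hle δ hδ.1 hδ.2

lemma uPackPre0_eq_zero_of_hasSeparatedBound {A : Set ℝ} {β α : ℝ} (hβ : 0 ≤ β) (hβα : β < α)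
    (hA : HasSeparatedBound A β) : uPackPre0 α A = 0 := by
  obtain ⟨γ, hβγ, hγα⟩ := exists_between hβα
  obtain ⟨ε, hε, hfin⟩ := exists_uPackPre_lt_top hβ hβγ hA
  exact uPackPre0_eq_zero_of_uPackPre_lt_top hγα (hβ.trans hβγ.le) hε hfin

/-- A set covered by countably many sets satisfying the separation bound with exponent `β` has
uncentered packing dimension at most `β`. -/
lemma uPackDim_le_of_cover {ι : Type*} [Countable ι] [Nonempty ι] {E : Set ℝ} {β : ℝ} (hβ : 0 ≤ β)
    (S : ι → Set ℝ) (hE : E ⊆ ⋃ i, S i) (hS : ∀ i, HasSeparatedBound (S i) β) :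
    uPackDim E ≤ ENNReal.ofReal β := by
  refine ENNReal.le_of_forall_pos_le_add fun δ hδ _ => ?_
  rw [← ENNReal.ofReal_coe_nnreal, ← ENNReal.ofReal_add hβ δ.coe_nonneg]
  have hlt : β < β + δ := by simpa using hδ
  refine iInf_le_of_le (β + δ) <| iInf_le_of_le (hβ.trans hlt.le) <| iInf_le_of_le ?_ le_rfl
  obtain ⟨f, hf⟩ := exists_surjective_nat ι
  refine le_antisymm ?_ zero_le
  refine iInf_le_of_le (S ∘ f) <| iInf_le_of_le ?_ ?_
  · exact hE.trans_eq (hf.iUnion_comp S).symm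
  · exact (ENNReal.tsum_eq_zero.2 fun n =>
      uPackPre0_eq_zero_of_hasSeparatedBound hβ hlt (hS (f n))).le

lemma hasSeparatedBound_singleton (x : ℝ) {β : ℝ} (hβ : 0 ≤ β) : HasSeparatedBound {x} β := by
  refine ⟨1, 1, one_pos, fun r hr hr1 F hF _ => ?_⟩
  have hcard : (F.card : ℝ) ≤ 1 := by
    have : F ⊆ {x} := by exact_mod_cast hF
    exact_mod_cast Finset.card_le_card this
  exact mul_le_one₀ hcard (by positivity) (Real.rpow_le_one hr.le hr1 hβ)

lemma hasSeparatedBound_of_cPackPre0_lt_top {A : Set ℝ} {β : ℝ} (hβ : 0 ≤ β)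
    (hA : cPackPre0 β A < ∞) : HasSeparatedBound A β := by
  simp only [cPackPre0, iInf_lt_iff] at hA
  obtain ⟨ε, hε, hA⟩ := hA
  refine ⟨ε, (cPackPre β ε A).toReal, hε, fun r hr hrε F hF hs => ?_⟩
  have hinj : Function.Injective fun x : ℝ => (x, r / 2) := fun x y h => congrArg Prod.fst h
  rw [← ENNReal.ofReal_le_iff_le_toReal hA.ne]
  refine le_iSup_of_le ((F.image fun x : ℝ => (x, r / 2) : Finset (ℝ × ℝ)) : Set (ℝ × ℝ)) <|
    le_iSup_of_le (Finset.countable_toSet _) <| le_iSup_of_le ?_ <| le_iSup_of_le ?_ ?_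
  · intro p hp
    obtain ⟨x, hx, rfl⟩ := Finset.mem_image.1 (Finset.mem_coe.1 hp)
    refine ⟨hF hx, by positivity, ?_⟩
    rw [emetricDiam_ball_real]
    exact ENNReal.ofReal_le_ofReal (by linarith)
  · intro p hp q hq hpq
    obtain ⟨x, hx, rfl⟩ := Finset.mem_image.1 (Finset.mem_coe.1 hp)
    obtain ⟨y, hy, rfl⟩ := Finset.mem_image.1 (Finset.mem_coe.1 hq)
    refine ball_disjoint_ball ?_
    have := hs hx hy fun h => hpq (h ▸ rfl)
    rw [Real.dist_eq]
    linarith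
  · rw [Finset.tsum_subtype' _ fun p : ℝ × ℝ => EMetric.diam (ball p.1 p.2) ^ β,
      Finset.sum_image hinj.injOn]
    simp only [emetricDiam_ball_real, mul_div_cancel₀ r (two_ne_zero), Finset.sum_const,
      nsmul_eq_mul]
    rw [ENNReal.ofReal_mul (by positivity), ENNReal.ofReal_natCast,
      ENNReal.ofReal_rpow_of_nonneg hr.le hβ]

lemma hasSeparatedBound_of_famPackPre0_lt_top {Φ : Set (Set ℝ)}
    (hΦ : ∀ S ∈ Φ, ∃ a b : ℝ, a < b ∧ 0 ≤ a ∧ b ≤ 1 ∧ S = Set.Ioo a b)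
    {C : ℝ} (hC : 0 < C)
    (h : ∀ a b : ℝ, 0 ≤ a → a < b → b ≤ 1 →
      ∃ Δ ∈ Φ, (a + b) / 2 ∈ Δ ∧ Δ ⊆ Set.Ioo a b ∧ (b - a) / Metric.diam Δ ≤ C)
    {A : Set ℝ} {β : ℝ} (hβ : 0 ≤ β) (hA : famPackPre0 β A Φ < ∞) {δ : ℝ} (hδ : 0 < δ) :
    HasSeparatedBound (A ∩ Icc δ (1 - δ)) β := by
  simp only [famPackPre0, iInf_lt_iff] at hA
  obtain ⟨ε, hε, hA⟩ := hA
  refine ⟨min ε δ, C ^ β * (famPackPre β ε A Φ).toReal, by positivity,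
    fun r hr hrε F hF hs => ?_⟩
  rw [le_min_iff] at hrε
  have hΔ : ∀ x : ℝ, ∃ Δ : Set ℝ, x ∈ F →
      Δ ∈ Φ ∧ x ∈ Δ ∧ Δ ⊆ ball x (r / 2) ∧ ENNReal.ofReal (r / C) ≤ EMetric.diam Δ := by
    intro x
    by_cases hx : x ∈ F
    · obtain ⟨_, hx1, hx2⟩ := hF hx
      obtain ⟨Δ, hΔ, hmid, hsub, hdiam⟩ :=
        h (x - r / 2) (x + r / 2) (by linarith) (by linarith) (by linarith)
      refine ⟨Δ, fun _ => ⟨hΔ, ?_, by rwa [Real.ball_eq_Ioo], ?_⟩⟩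
      · convert hmid using 1
        ring
      · obtain ⟨a, b, hab, _, _, rfl⟩ := hΦ Δ hΔ
        change _ ≤ Metric.ediam (Ioo a b)
        rw [Real.diam_Ioo hab.le, div_le_iff₀ (sub_pos.2 hab)] at hdiam
        rw [Real.ediam_Ioo]
        refine ENNReal.ofReal_le_ofReal ?_
        rw [div_le_iff₀ hC]
        linarith
    · exact ⟨∅, fun h => absurd h hx⟩
  choose Δ hΔ using hΔ
  have hdisj : ∀ x ∈ F, ∀ y ∈ F, x ≠ y → Disjoint (Δ x) (Δ y) := by
    intro x hx y hy hxy
    refine Disjoint.mono (hΔ x hx).2.2.1 (hΔ y hy).2.2.1 (ball_disjoint_ball ?_)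
    have := hs hx hy hxy
    rw [Real.dist_eq]
    linarith
  have hinj : Set.InjOn Δ F := by
    intro x hx y hy hxy
    by_contra hne
    exact Set.disjoint_left.1 (hdisj x hx y hy hne) (hΔ x hx).2.1 (hxy ▸ (hΔ x hx).2.1)
  have key : ENNReal.ofReal (F.card * (r / C) ^ β) ≤ famPackPre β ε A Φ := by
    refine le_iSup_of_le ((F.image Δ : Finset (Set ℝ)) : Set (Set ℝ)) <|
      le_iSup_of_le (Finset.countable_toSet _) <| le_iSup_of_le ?_ <| le_iSup_of_le ?_ <|
      le_iSup_of_le ?_ ?_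
    · intro B hB
      obtain ⟨x, hx, rfl⟩ := Finset.mem_image.1 (Finset.mem_coe.1 hB)
      exact (hΔ x hx).1
    · intro B hB
      obtain ⟨x, hx, rfl⟩ := Finset.mem_image.1 (Finset.mem_coe.1 hB)
      refine ⟨⟨x, (hΔ x hx).2.1, (hF hx).1⟩, ?_⟩
      refine (Metric.ediam_mono (hΔ x hx).2.2.1).trans ?_
      refine (emetricDiam_ball_real _ _).trans_le (ENNReal.ofReal_le_ofReal ?_)
      linarith
    · intro B hB B' hB' hne
      obtain ⟨x, hx, rfl⟩ := Finset.mem_image.1 (Finset.mem_coe.1 hB)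
      obtain ⟨y, hy, rfl⟩ := Finset.mem_image.1 (Finset.mem_coe.1 hB')
      exact hdisj x hx y hy fun h => hne (h ▸ rfl)
    · rw [Finset.tsum_subtype' _ fun B : Set ℝ => EMetric.diam B ^ β, Finset.sum_image hinj,
        ENNReal.ofReal_mul (by positivity), ENNReal.ofReal_natCast,
        ← ENNReal.ofReal_rpow_of_nonneg (by positivity) hβ, ← nsmul_eq_mul]
      refine Finset.card_nsmul_le_sum _ _ _ fun x hx => ?_
      exact ENNReal.rpow_le_rpow (hΔ x hx).2.2.2 hβ
  rw [ENNReal.ofReal_le_iff_le_toReal hA.ne, Real.div_rpow hr.le hC.le, ← mul_div_assoc,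
    div_le_iff₀ (by positivity)] at key
  linarith

lemma famPackPre_le_uPackPre {Φ : Set (Set ℝ)}
    (hΦ : ∀ S ∈ Φ, ∃ a b : ℝ, a < b ∧ S = Set.Ioo a b) (α ε : ℝ) (E : Set ℝ) :
    famPackPre α ε E Φ ≤ uPackPre α ε E := by
  refine iSup_le fun P => iSup_le fun hc => iSup_le fun hP => iSup_le fun hm => iSup_le fun hd => ?_
  have hball : ∀ B : Set ℝ, ∃ p : ℝ × ℝ, B ∈ P → 0 < p.2 ∧ ball p.1 p.2 = B := by
    intro B
    by_cases hB : B ∈ P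
    · obtain ⟨a, b, hab, rfl⟩ := hΦ B (hP hB)
      exact ⟨((a + b) / 2, (b - a) / 2), fun _ => ⟨by simpa using hab, (Real.Ioo_eq_ball a b).symm⟩⟩
    · exact ⟨0, fun h => absurd h hB⟩
  choose g hg using hball
  have hinj : Set.InjOn g P := fun B hB B' hB' hBB' => by
    rw [← (hg B hB).2, ← (hg B' hB').2, hBB']
  refine le_iSup_of_le (g '' P) <| le_iSup_of_le (hc.image g) <| le_iSup_of_le ?_ <|
    le_iSup_of_le ?_ ?_
  · rintro _ ⟨B, hB, rfl⟩
    rw [(hg B hB).2]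
    exact ⟨(hm B hB).1, (hg B hB).1, (hm B hB).2⟩
  · rintro _ ⟨B, hB, rfl⟩ _ ⟨B', hB', rfl⟩ hne
    rw [(hg B hB).2, (hg B' hB').2]
    exact hd hB hB' fun h => hne (h ▸ rfl)
  · rw [tsum_image (fun p : ℝ × ℝ => EMetric.diam (ball p.1 p.2) ^ α) hinj]
    exact ENNReal.tsum_le_tsum fun B => by rw [(hg B.1 B.2).2]

lemma famPackDim_le_uPackDim {Φ : Set (Set ℝ)}
    (hΦ : ∀ S ∈ Φ, ∃ a b : ℝ, a < b ∧ S = Set.Ioo a b) (E : Set ℝ) :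
    famPackDim E Φ ≤ uPackDim E := by
  refine iInf_mono fun α => iInf_mono fun _ => iInf_mono' fun h0 => ⟨?_, le_rfl⟩
  refine le_antisymm (h0 ▸ ?_) zero_le
  exact iInf₂_mono fun c _ => ENNReal.tsum_le_tsum fun n =>
    iInf₂_mono fun ε _ => famPackPre_le_uPackPre hΦ α ε (c n)

lemma cPackPre_le_uPackPre {M : Type*} [MetricSpace M] (α ε : ℝ) (E : Set M) :
    cPackPre α ε E ≤ uPackPre α ε E :=
  iSup_mono fun _ => iSup_mono fun _ => iSup_mono' fun hP =>
    ⟨fun p hp => ⟨⟨p.1, mem_ball_self (hP p hp).2.1, (hP p hp).1⟩, (hP p hp).2⟩, le_rfl⟩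

lemma cPackDim_le_uPackDim {M : Type*} [MetricSpace M] (E : Set M) :
    cPackDim E ≤ uPackDim E := by
  refine iInf_mono fun α => iInf_mono fun _ => iInf_mono' fun h0 => ⟨?_, le_rfl⟩
  refine le_antisymm (h0 ▸ ?_) zero_le
  exact iInf₂_mono fun c _ => ENNReal.tsum_le_tsum fun n =>
    iInf₂_mono fun ε _ => cPackPre_le_uPackPre α ε (c n)

lemma uPackDim_le_cPackDim (E : Set ℝ) : uPackDim E ≤ cPackDim E := by
  refine le_iInf fun β => le_iInf fun hβ => le_iInf fun h0 => ?_
  have hlt : cPackMeasure β E < ∞ := h0 ▸ ENNReal.zero_lt_top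
  simp only [cPackMeasure, iInf_lt_iff] at hlt
  obtain ⟨c, hc, hlt⟩ := hlt
  exact uPackDim_le_of_cover hβ c hc fun n =>
    hasSeparatedBound_of_cPackPre0_lt_top hβ ((ENNReal.le_tsum n).trans_lt hlt)

lemma uPackDim_le_famPackDim {Φ : Set (Set ℝ)}
    (hΦ : ∀ S ∈ Φ, ∃ a b : ℝ, a < b ∧ 0 ≤ a ∧ b ≤ 1 ∧ S = Set.Ioo a b)
    {C : ℝ} (hC : 0 < C)
    (h : ∀ a b : ℝ, 0 ≤ a → a < b → b ≤ 1 →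
      ∃ Δ ∈ Φ, (a + b) / 2 ∈ Δ ∧ Δ ⊆ Set.Ioo a b ∧ (b - a) / Metric.diam Δ ≤ C)
    {E : Set ℝ} (hE : E ⊆ Set.Icc 0 1) : uPackDim E ≤ famPackDim E Φ := by
  refine le_iInf fun β => le_iInf fun hβ => le_iInf fun h0 => ?_
  have hlt : famPackMeasure β E Φ < ∞ := h0 ▸ ENNReal.zero_lt_top
  simp only [famPackMeasure, iInf_lt_iff] at hlt
  obtain ⟨c, hc, hlt⟩ := hlt
  let S : Bool ⊕ (ℕ × ℕ) → Set ℝ :=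
    Sum.elim (fun b => if b then {0} else {1})
      fun i => c i.1 ∩ Icc (1 / ((i.2 : ℝ) + 1)) (1 - 1 / ((i.2 : ℝ) + 1))
  refine uPackDim_le_of_cover hβ S (fun x hx => ?_) ?_
  · rw [mem_iUnion]
    obtain ⟨hx0, hx1⟩ := hE hx
    rcases hx0.eq_or_lt with rfl | hx0
    · exact ⟨Sum.inl true, by simp [S]⟩
    rcases hx1.eq_or_lt with rfl | hx1
    · exact ⟨Sum.inl false, by simp [S]⟩
    obtain ⟨n, hn⟩ := mem_iUnion.1 (hc hx)
    obtain ⟨m, hm⟩ := exists_nat_one_div_lt (lt_min hx0 (sub_pos.2 hx1))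
    rw [lt_min_iff] at hm
    exact ⟨Sum.inr (n, m), hn, hm.1.le, by linarith [hm.2]⟩
  · rintro ((_ | _) | ⟨n, m⟩)
    · simpa [S] using hasSeparatedBound_singleton 1 hβ
    · simpa [S] using hasSeparatedBound_singleton 0 hβ
    · exact hasSeparatedBound_of_famPackPre0_lt_top hΦ hC h hβ
        ((ENNReal.le_tsum n).trans_lt hlt) (by positivity)

/-- If `Φ` is a family of open subintervals of `[0,1]` such that for some
`C > 0` every interval `(a,b) ⊆ [0,1]` contains an interval `Δ(a,b) ∈ Φ` containing the
midpoint `(a+b)/2` with `(b-a)/|Δ(a,b)| ≤ C`, then `Φ` is faithful for the packing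
dimension calculation: `dim_P(E,Φ) = dim_{P(unc)}(E) = dim_P(E)` for every `E ⊆ [0,1]`. -/
theorem statement4 (Φ : Set (Set ℝ))
    (hΦ : ∀ S ∈ Φ, ∃ a b : ℝ, a < b ∧ 0 ≤ a ∧ b ≤ 1 ∧ S = Set.Ioo a b)
    (C : ℝ) (hC : 0 < C)
    (h : ∀ a b : ℝ, 0 ≤ a → a < b → b ≤ 1 →
      ∃ Δ ∈ Φ, (a + b) / 2 ∈ Δ ∧ Δ ⊆ Set.Ioo a b ∧ (b - a) / Metric.diam Δ ≤ C)
    (E : Set ℝ) (hE : E ⊆ Set.Icc 0 1) :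
    famPackDim E Φ = uPackDim E ∧ uPackDim E = cPackDim E := by
  have hΦ' : ∀ S ∈ Φ, ∃ a b : ℝ, a < b ∧ S = Set.Ioo a b := fun S hS =>
    let ⟨a, b, hab, _, _, hS⟩ := hΦ S hS
    ⟨a, b, hab, hS⟩
  exact ⟨le_antisymm (famPackDim_le_uPackDim hΦ' E) (uPackDim_le_famPackDim hΦ hC h hE),
    le_antisymm (uPackDim_le_cPackDim E) (cPackDim_le_uPackDim E)⟩

end
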